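/- Let (u, ρ) be a smooth periodic solution on [0,T) of the periodic two-component Hunter–Saxton system with parameter k = 1. If there exists M > 0 such that |u_x(t,x)| ≤ M for all (t,x) ∈ [0,T) × ℝ, then for all t ∈ [0,T), sup_{x ∈ ℝ} |ρ_x(t,x)| ≤ K · e^{2 M t}, where K = sup_{x ∈ ℝ} |u_xx(0,x)| + sup_{x ∈ ℝ} |ρ_x(0,x)|. -/

import Mathlib

open Real Set MeasureTheory intervalIntegral

/-- Partial derivative in the space variable (second argument). -/
noncomputable def pdx (f : ℝ → ℝ → ℝ) : ℝ → ℝ → ℝ := fun t x => deriv (f t) x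

/-- Partial derivative in the time variable (first argument). -/
noncomputable def pdt (f : ℝ → ℝ → ℝ) : ℝ → ℝ → ℝ := fun t x => deriv (fun s => f s x) t

open Function

theorem ContDiff.hasDerivAt_fderiv_space {f : ℝ → ℝ → ℝ} (hf : ContDiff ℝ (⊤ : ℕ∞) (uncurry f))
    (t x : ℝ) : HasDerivAt (f t) (fderiv ℝ (uncurry f) (t, x) (0, 1)) x := by
  have h := (hf.differentiable (by simp) (t, x)).hasFDerivAt
  exact h.comp_hasDerivAt x ((hasDerivAt_const x t).prodMk (hasDerivAt_id x))

theorem ContDiff.hasDerivAt_fderiv_time {f : ℝ → ℝ → ℝ} (hf : ContDiff ℝ (⊤ : ℕ∞) (uncurry f))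
    (t x : ℝ) : HasDerivAt (fun s => f s x) (fderiv ℝ (uncurry f) (t, x) (1, 0)) t := by
  have h := (hf.differentiable (by simp) (t, x)).hasFDerivAt
  exact h.comp_hasDerivAt t ((hasDerivAt_id t).prodMk (hasDerivAt_const t x))

theorem ContDiff.uncurry_pdx_eq {f : ℝ → ℝ → ℝ} (hf : ContDiff ℝ (⊤ : ℕ∞) (uncurry f)) :
    uncurry (pdx f) = fun p => fderiv ℝ (uncurry f) p (0, 1) :=
  funext fun p => (hf.hasDerivAt_fderiv_space p.1 p.2).deriv

theorem ContDiff.uncurry_pdt_eq {f : ℝ → ℝ → ℝ} (hf : ContDiff ℝ (⊤ : ℕ∞) (uncurry f)) :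
    uncurry (pdt f) = fun p => fderiv ℝ (uncurry f) p (1, 0) :=
  funext fun p => (hf.hasDerivAt_fderiv_time p.1 p.2).deriv

theorem ContDiff.uncurry_pdx {f : ℝ → ℝ → ℝ} (hf : ContDiff ℝ (⊤ : ℕ∞) (uncurry f)) :
    ContDiff ℝ (⊤ : ℕ∞) (uncurry (pdx f)) := by
  rw [hf.uncurry_pdx_eq]
  exact (hf.fderiv_right (m := (⊤ : ℕ∞)) (by simp)).clm_apply contDiff_const

theorem ContDiff.uncurry_pdt {f : ℝ → ℝ → ℝ} (hf : ContDiff ℝ (⊤ : ℕ∞) (uncurry f)) :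
    ContDiff ℝ (⊤ : ℕ∞) (uncurry (pdt f)) := by
  rw [hf.uncurry_pdt_eq]
  exact (hf.fderiv_right (m := (⊤ : ℕ∞)) (by simp)).clm_apply contDiff_const

theorem ContDiff.hasDerivAt_pdx {f : ℝ → ℝ → ℝ} (hf : ContDiff ℝ (⊤ : ℕ∞) (uncurry f))
    (t x : ℝ) : HasDerivAt (f t) (pdx f t x) x :=
  (hf.hasDerivAt_fderiv_space t x).differentiableAt.hasDerivAt

theorem ContDiff.hasDerivAt_pdt {f : ℝ → ℝ → ℝ} (hf : ContDiff ℝ (⊤ : ℕ∞) (uncurry f))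
    (t x : ℝ) : HasDerivAt (fun s => f s x) (pdt f t x) t :=
  (hf.hasDerivAt_fderiv_time t x).differentiableAt.hasDerivAt

theorem ContDiff.pdt_pdx_comm {f : ℝ → ℝ → ℝ} (hf : ContDiff ℝ (⊤ : ℕ∞) (uncurry f)) (t x : ℝ) :
    pdt (pdx f) t x = pdx (pdt f) t x := by
  have hd : DifferentiableAt ℝ (fderiv ℝ (uncurry f)) (t, x) :=
    (hf.fderiv_right (m := (⊤ : ℕ∞)) (by simp)).differentiable (by simp) _
  have hsymm : IsSymmSndFDerivAt ℝ (uncurry f) (t, x) :=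
    hf.contDiffAt.isSymmSndFDerivAt (by
      rw [minSmoothness_of_isRCLikeNormedField]
      exact WithTop.coe_le_coe.2 (le_top : (2 : ℕ∞) ≤ ⊤))
  have h₁ : pdt (pdx f) t x = fderiv ℝ (uncurry (pdx f)) (t, x) (1, 0) :=
    (hf.uncurry_pdx.hasDerivAt_fderiv_time t x).deriv
  have h₂ : pdx (pdt f) t x = fderiv ℝ (uncurry (pdt f)) (t, x) (0, 1) :=
    (hf.uncurry_pdt.hasDerivAt_fderiv_space t x).deriv
  rw [h₁, h₂, hf.uncurry_pdx_eq, hf.uncurry_pdt_eq, fderiv_clm_apply hd (by fun_prop),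
    fderiv_clm_apply hd (by fun_prop)]
  simpa using hsymm (1, 0) (0, 1)

theorem pdx_add_period {f : ℝ → ℝ → ℝ} {c : ℝ} (hf : ∀ t x, f t (x + c) = f t x) (t x : ℝ) :
    pdx f t (x + c) = pdx f t x := by
  simp only [pdx]
  rw [← deriv_comp_add_const]
  simp only [hf]

theorem HasDerivAt.nonneg_of_forall_le_left {g : ℝ → ℝ} {g' a b : ℝ} (hab : a < b)
    (hg : HasDerivAt g g' b) (hle : ∀ s ∈ Icc a b, g s ≤ g b) : 0 ≤ g' := by
  have h := (hasDerivWithinAt_iff_tendsto_slope' self_notMem_Iio).1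
    (hg.hasDerivWithinAt (s := Iio b))
  refine ge_of_tendsto h ?_
  filter_upwards [Ioo_mem_nhdsLT hab] with s hs
  rw [slope_def_field]
  exact div_nonneg_of_nonpos (sub_nonpos.2 (hle s ⟨hs.1.le, hs.2.le⟩)) (sub_nonpos.2 hs.2.le)

/-- Maximum principle: a function that is periodic in space and does not increase in time at its
spatial critical points stays below any upper bound of its initial values. -/
theorem le_of_pdt_nonpos_of_pdx_eq_zero {F : ℝ → ℝ → ℝ}
    (hF : ContDiff ℝ (⊤ : ℕ∞) (uncurry F)) (hper : ∀ t x, F t (x + 1) = F t x) {τ C : ℝ}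
    (h0 : ∀ x, F 0 x ≤ C)
    (hcrit : ∀ s ∈ Ioc 0 τ, ∀ x, pdx F s x = 0 → pdt F s x ≤ 0) (hτ : 0 ≤ τ) (x : ℝ) :
    F τ x ≤ C := by
  suffices h : ∀ ε > 0, F τ x - ε * τ ≤ C by
    refine le_of_forall_pos_le_add fun δ hδ => ?_
    have h₁ := h (δ / (τ + 1)) (by positivity)
    have h₂ : δ / (τ + 1) * τ ≤ δ := by
      rw [div_mul_eq_mul_div, div_le_iff₀ (by positivity)]
      nlinarith
    linarith
  intro ε hε
  have hcont : Continuous (uncurry F) := hF.continuous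
  obtain ⟨⟨s, y⟩, ⟨hs, hy⟩, hmax⟩ := (isCompact_Icc.prod isCompact_Icc).exists_isMaxOn
    (s := Icc (0 : ℝ) τ ×ˢ Icc (0 : ℝ) 1) ⟨(0, 0), by simp [hτ]⟩
    (f := fun p => uncurry F p - ε * p.1) (by fun_prop)
  have hglob : ∀ r ∈ Icc (0 : ℝ) τ, ∀ z, F r z - ε * r ≤ F s y - ε * s := by
    intro r hr z
    obtain ⟨w, hw, hzw⟩ := Periodic.exists_mem_Ico₀ (hper r) one_pos z
    rw [hzw]
    exact hmax (show (r, w) ∈ _ from ⟨hr, hw.1, hw.2.le⟩)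
  refine (hglob τ ⟨hτ, le_rfl⟩ x).trans ?_
  rcases hs.1.eq_or_lt with rfl | hpos
  · simpa using h0 y
  have hx : pdx F s y = 0 :=
    IsLocalMax.deriv_eq_zero (Filter.Eventually.of_forall fun z => by simpa using hglob s hs z)
  have ht : 0 ≤ pdt F s y - ε * 1 :=
    HasDerivAt.nonneg_of_forall_le_left (g := fun r => F r y - ε * r) hpos
      ((hF.hasDerivAt_pdt s y).sub ((hasDerivAt_id s).const_mul ε))
      fun r hr => hglob r ⟨hr.1, hr.2.trans hs.2⟩ y
  linarith [hcrit s ⟨hpos, hs.2⟩ y hx]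

theorem abs_le_iSup_of_periodic {f : ℝ → ℝ} (hf : Continuous f) (hper : Periodic f 1) (x : ℝ) :
    |f x| ≤ ⨆ y, |f y| := by
  have habs : Periodic (fun y => |f y|) 1 := fun y => by simp only [hper y]
  exact le_ciSup (habs.compact_of_continuous one_ne_zero hf.abs).bddAbove x

theorem hunter_saxton_rho_x_bound (T : EReal) (hT : 0 < T)
    (u ρ : ℝ → ℝ → ℝ)
    (hu : ContDiff ℝ (⊤ : ℕ∞) (Function.uncurry u)) (hρ : ContDiff ℝ (⊤ : ℕ∞) (Function.uncurry ρ))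
    (huper : ∀ t x : ℝ, u t (x + 1) = u t x) (hρper : ∀ t x : ℝ, ρ t (x + 1) = ρ t x)
    (heq1 : ∀ t x : ℝ, 0 ≤ t → (t : EReal) < T →
      pdt (pdx (pdx u)) t x + 2 * pdx u t x * pdx (pdx u) t x
        + u t x * pdx (pdx (pdx u)) t x - 1 * ρ t x * pdx ρ t x = 0)
    (heq2 : ∀ t x : ℝ, 0 ≤ t → (t : EReal) < T →
      pdt ρ t x + pdx (fun s y => ρ s y * u s y) t x = 0)
    (M : ℝ) (hM : 0 < M)
    (hbound : ∀ t x : ℝ, 0 ≤ t → (t : EReal) < T → |pdx u t x| ≤ M) :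
    ∀ t : ℝ, 0 ≤ t → (t : EReal) < T →
      ∀ x, |pdx ρ t x| ≤
        ((⨆ y, |pdx (pdx u) 0 y|) + ⨆ y, |pdx ρ 0 y|) * Real.exp (2 * M * t) := by
  intro t ht htT x
  set A := ⨆ y, |pdx (pdx u) 0 y|
  set B := ⨆ y, |pdx ρ 0 y|
  have hω := hu.uncurry_pdx.uncurry_pdx
  have hη := hρ.uncurry_pdx
  have hωper := pdx_add_period (pdx_add_period huper)
  have hηper := pdx_add_period hρper
  have hA : ∀ y, |pdx (pdx u) 0 y| ≤ A :=
    abs_le_iSup_of_periodic (hω.continuous.comp (Continuous.prodMk_right 0)) (hωper 0)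
  have hB : ∀ y, |pdx ρ 0 y| ≤ B :=
    abs_le_iSup_of_periodic (hη.continuous.comp (Continuous.prodMk_right 0)) (hηper 0)
  have hA0 : 0 ≤ A := (abs_nonneg _).trans (hA 0)
  have hB0 : 0 ≤ B := (abs_nonneg _).trans (hB 0)
  have hηt : ∀ s y : ℝ, 0 ≤ s → (s : EReal) < T →
      pdt (pdx ρ) s y
        = -(2 * pdx u s y * pdx ρ s y + u s y * pdx (pdx ρ) s y + ρ s y * pdx (pdx u) s y) := by
    intro s y hs hsT
    rw [hρ.pdt_pdx_comm]
    have heq : pdt ρ s = fun z => -(pdx ρ s z * u s z + ρ s z * pdx u s z) := by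
      funext z
      have h := heq2 s z hs hsT
      have h' : pdx (fun s y => ρ s y * u s y) s z = pdx ρ s z * u s z + ρ s z * pdx u s z :=
        ((hρ.hasDerivAt_pdx s z).mul (hu.hasDerivAt_pdx s z)).deriv
      linarith
    have hd := (((hη.hasDerivAt_pdx s y).mul (hu.hasDerivAt_pdx s y)).add
      ((hρ.hasDerivAt_pdx s y).mul (hu.uncurry_pdx.hasDerivAt_pdx s y))).neg
    have h : pdx (pdt ρ) s y = _ := (congrArg (fun g => deriv g y) heq).trans hd.deriv
    rw [h]
    ring
  let F : ℝ → ℝ → ℝ := fun s y =>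
    ((pdx (pdx u) s y) ^ 2 + (pdx ρ s y) ^ 2) * Real.exp (-(4 * M) * s)
  have hF : ContDiff ℝ (⊤ : ℕ∞) (uncurry F) :=
    ((hω.pow 2).add (hη.pow 2)).mul (contDiff_const.mul contDiff_fst).exp
  have hFper : ∀ s y, F s (y + 1) = F s y := fun s y => by simp only [F, hωper, hηper]
  have hF0 : ∀ y, F 0 y ≤ (A + B) ^ 2 := by
    intro y
    have h₁ := pow_le_pow_left₀ (abs_nonneg _) (hA y) 2
    have h₂ := pow_le_pow_left₀ (abs_nonneg _) (hB y) 2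
    rw [sq_abs] at h₁ h₂
    simp only [F, mul_zero, Real.exp_zero, mul_one]
    nlinarith [mul_nonneg hA0 hB0]
  have hcrit : ∀ s ∈ Ioc 0 t, ∀ y, pdx F s y = 0 → pdt F s y ≤ 0 := by
    intro s hs y hx
    have hsT : (s : EReal) < T := (EReal.coe_le_coe_iff.2 hs.2).trans_lt htT
    have hFx : pdx F s y = _ := ((((hω.hasDerivAt_pdx s y).pow 2).add
      ((hη.hasDerivAt_pdx s y).pow 2)).mul_const (Real.exp (-(4 * M) * s))).deriv
    have hFt : pdt F s y = _ := ((((hω.hasDerivAt_pdt s y).pow 2).add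
      ((hη.hasDerivAt_pdt s y).pow 2)).mul
        ((hasDerivAt_id s).const_mul (-(4 * M))).exp).deriv
    have hE := Real.exp_pos (-(4 * M) * s)
    rw [hFx, mul_eq_zero, or_iff_left hE.ne'] at hx
    have hb := (abs_le.1 (hbound s y hs.1.le hsT)).1
    have h₁ := heq1 s y hs.1.le hsT
    have h₂ := hηt s y hs.1.le hsT
    have hωt : pdt (pdx (pdx u)) s y = ρ s y * pdx ρ s y - 2 * pdx u s y * pdx (pdx u) s y
        - u s y * pdx (pdx (pdx u)) s y := by linarith
    have key : pdt F s y = -(4 * (pdx u s y + M)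
        * ((pdx (pdx u) s y) ^ 2 + (pdx ρ s y) ^ 2) * Real.exp (-(4 * M) * s)) := by
      rw [hFt, hωt, h₂]
      simp only [Pi.add_apply, Pi.pow_apply, id] at hx ⊢
      linear_combination (-(u s y) * Real.exp (-(4 * M) * s)) * hx
    rw [key, neg_nonpos]
    have : 0 ≤ pdx u s y + M := by linarith
    positivity
  have hmain := le_of_pdt_nonpos_of_pdx_eq_zero hF hFper hF0 hcrit ht x
  have hexp : Real.exp (-(4 * M) * t) * Real.exp (2 * M * t) ^ 2 = 1 := by
    rw [← Real.exp_nat_mul, ← Real.exp_add, Real.exp_eq_one_iff]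
    push_cast
    ring
  refine abs_le_of_sq_le_sq ?_ (by positivity)
  calc (pdx ρ t x) ^ 2 ≤ (pdx (pdx u) t x) ^ 2 + (pdx ρ t x) ^ 2 := by
        linarith [sq_nonneg (pdx (pdx u) t x)]
    _ = F t x * Real.exp (2 * M * t) ^ 2 := by
        simp only [F]
        rw [mul_assoc, hexp, mul_one]
    _ ≤ (A + B) ^ 2 * Real.exp (2 * M * t) ^ 2 := by gcongr
    _ = ((A + B) * Real.exp (2 * M * t)) ^ 2 := by ring
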